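/- |i(∞,30) − 0.29348611| < 5·10^{-9}; that is, the limiting proportion i(∞,30) of permutations fixing a 30-set equals 0.29348611 to eight decimal places. -/

import Mathlib

/-- The partition with `m j` parts of size `(j:ℕ)+1` for `j : Fin k` has a subpartition of
size `s`. -/
def HasSubpartitionFin (k : ℕ) (m : Fin k → ℕ) (s : ℕ) : Prop :=
  ∃ c : Fin k → ℕ, (∀ j, c j ≤ m j) ∧ ∑ j : Fin k, ((j : ℕ) + 1) * c j = s

/-- `pInf k = p(∞,k)`: the convergent sum of `∏_{j=1}^{k} e^{-1/j}·(1/j)^{m_j}/m_j!` over all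
`k`-free multiplicity vectors `(m_1,…,m_k) ∈ ℕ^k`. -/
noncomputable def pInf (k : ℕ) : ℝ :=
  ∑' m : {m : Fin k → ℕ // ¬ HasSubpartitionFin k m k},
    ∏ j : Fin k, Real.exp (-(1 / ((j : ℕ) + 1 : ℝ))) * (1 / ((j : ℕ) + 1 : ℝ)) ^ (m.1 j) /
      (Nat.factorial (m.1 j) : ℝ)

inductive Tr where
  | nil : Tr
  | node (l : Tr) (h k w : ℕ) (r : Tr) : Tr

def forceNat {α : Type} (n : ℕ) (f : ℕ → α) : α :=
  Nat.rec (f 0) (fun n _ => f (Nat.succ n)) n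

def hsh (j k : ℕ) : ℕ := Nat.mod (Nat.mul k (Nat.add k (Nat.mul j 2654435761))) 4294967291

noncomputable def insK {α : Type} (h k w : ℕ) (t : Tr) : (Tr → α) → α :=
  Tr.rec (motive := fun _ => (Tr → α) → α)
    (fun cont => cont (.node .nil h k w .nil))
    (fun l h' k' w' r ihl ihr cont =>
      Bool.rec
        (Bool.rec (ihr fun r' => cont (.node l h' k' w' r'))
          (ihl fun l' => cont (.node l' h' k' w' r)) (Nat.ble h h'))
        (forceNat (Nat.add w' w) fun x => cont (.node l h' k' x r))
        (Nat.beq k k')) t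

noncomputable def expandK {α : Type} (j k w p : ℕ) (xs : List ℕ) :
    ℕ → Tr → (Tr → α) → α :=
  List.rec (motive := fun _ => ℕ → Tr → (Tr → α) → α)
    (fun _ acc cont => cont acc)
    (fun x _ ih t acc cont =>
      Bool.rec
        (forceNat (Nat.mod t p) fun q =>
          forceNat (hsh j q) fun h =>
          forceNat (Nat.mul w x) fun y =>
          insK h q y acc fun acc' =>
          forceNat (Nat.lor k (Nat.shiftLeft t j)) fun t' => ih t' acc' cont)
        (forceNat (Nat.lor k (Nat.shiftLeft t j)) fun t' => ih t' acc cont)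
        (Nat.beq (Nat.mod (Nat.div t 1073741824) 2) 1)) xs

noncomputable def stepK {α : Type} (j p : ℕ) (xs : List ℕ) (t : Tr) : Tr → (Tr → α) → α :=
  Tr.rec (motive := fun _ => Tr → (Tr → α) → α)
    (fun acc cont => cont acc)
    (fun _ _ k w _ ihl ihr acc cont =>
      expandK j k w p xs k acc fun acc1 =>
      ihl acc1 fun acc2 => ihr acc2 cont) t

/-- The scale; it is odd, so that low bits of the products stay well distributed. -/
def dsc : ℕ := 12157665459056928801

/-- `e = 0`: a lower bound, `e = 1`: an upper bound for `dsc / (j ^ i * i !)`. -/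
def wgt (e j i : ℕ) : ℕ := Nat.add (Nat.div dsc (Nat.mul (Nat.pow j i) (Nat.factorial i))) e

/-- `wgt e j i + ... + wgt e j (i + n - 1)`. -/
def wsum (e j : ℕ) : ℕ → ℕ → ℕ
  | _, 0 => 0
  | i, n + 1 => Nat.add (wgt e j i) (wsum e j (i + 1) n)

def wtail (e j m : ℕ) : ℕ := Nat.add (wsum e j m (Nat.sub 31 m)) e

/-- `[wgt e j i, ..., wgt e j (i + n - 1), wtail e j (i + n)]`. -/
def wlist (e j : ℕ) : ℕ → ℕ → List ℕ
  | i, 0 => [wtail e j i]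
  | i, n + 1 => wgt e j i :: wlist e j (i + 1) n

/-- Evaluate a list of numbers before passing it on. -/
def listForce {α : Type} (xs : List ℕ) (f : List ℕ → α) : α :=
  match xs with
  | [] => f []
  | x :: xs => forceNat x fun y => listForce xs fun ys => f (y :: ys)

/-- run `n` stages, starting after parts `≤ j` have been processed. -/
noncomputable def runK {α : Type} (e : ℕ) (n j : ℕ) (t : Tr) (cont : Tr → α) : α :=
  match n with
  | 0 => cont t
  | n + 1 =>
    listForce (wlist e (j + 1) 0 (30 / (j + 1))) fun xs =>
    stepK (j + 1) (Nat.pow 2 (Nat.sub 29 j)) xs t .nil fun t' =>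
    runK e n (j + 1) t' cont

def wt : Tr → ℕ
  | .nil => 0
  | .node l _ _ w r => wt l + w + wt r

/-- Total weight of the nodes with key `0`. -/
def wt0 : Tr → ℕ
  | .nil => 0
  | .node l _ k w r => wt0 l + (cond (Nat.beq k 0) w 0) + wt0 r

def prodA (e : ℕ) : ℕ → ℕ
  | 0 => 1
  | n + 1 => prodA e n * wtail e (n + 1) 0
theorem forceNat_eq {α : Type} (n : ℕ) (f : ℕ → α) : forceNat n f = f n := by
  cases n <;> rfl

theorem listForce_eq {α : Type} (xs : List ℕ) : ∀ f : List ℕ → α, listForce xs f = f xs := by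
  induction xs with
  | nil => intro f; rfl
  | cons x xs ih => intro f; simp only [listForce, forceNat_eq, ih]

open scoped ENNReal

/-- Total weight of a tree against a value function. -/
noncomputable def tot (V : ℕ → ℝ≥0∞) : Tr → ℝ≥0∞
  | .nil => 0
  | .node l _ k w r => tot V l + (w : ℝ≥0∞) * V k + tot V r

theorem insK_spec {α : Type} (V : ℕ → ℝ≥0∞) (h k w : ℕ) (t : Tr) :
    ∀ cont : Tr → α, ∃ t', insK h k w t cont = cont t' ∧
      tot V t' = tot V t + (w : ℝ≥0∞) * V k := by
  induction t with
  | nil =>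
    intro cont
    exact ⟨.node .nil h k w .nil, rfl, by simp [tot]⟩
  | node l h' k' w' r ihl ihr =>
    intro cont
    have hun : insK h k w (.node l h' k' w' r) cont =
        Bool.rec
        (Bool.rec (insK h k w r fun r' => cont (.node l h' k' w' r'))
          (insK h k w l fun l' => cont (.node l' h' k' w' r)) (Nat.ble h h'))
        (forceNat (Nat.add w' w) fun x => cont (.node l h' k' x r))
        (Nat.beq k k') := rfl
    rw [hun]
    cases hb : Nat.beq k k' with
    | true =>
      have : k = k' := Nat.eq_of_beq_eq_true hb
      subst this
      refine ⟨.node l h' k (w' + w) r, forceNat_eq _ _, ?_⟩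
      simp only [tot]; push_cast; ring
    | false =>
      cases Nat.ble h h' with
      | true =>
        obtain ⟨t', h1, h2⟩ := ihl (fun l' => cont (.node l' h' k' w' r))
        refine ⟨_, h1, ?_⟩
        simp only [tot, h2]; ring
      | false =>
        obtain ⟨t', h1, h2⟩ := ihr (fun r' => cont (.node l h' k' w' r'))
        refine ⟨_, h1, ?_⟩
        simp only [tot, h2]; ring

noncomputable def esum (V : ℕ → ℝ≥0∞) (j k : ℕ) : List ℕ → ℕ → ℝ≥0∞
  | [], _ => 0
  | x :: xs, t => (x : ℝ≥0∞) * V t + esum V j k xs (k ||| t <<< j)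

theorem bit30 (t : ℕ) : Nat.beq (Nat.mod (Nat.div t 1073741824) 2) 1 = t.testBit 30 := by
  rw [Nat.testBit_eq_decide_div_mod_eq, Bool.eq_iff_iff, decide_eq_true_iff]
  exact ⟨fun h => Nat.eq_of_beq_eq_true h, fun h => by
    have h' : Nat.mod (Nat.div t 1073741824) 2 = 1 := h
    rw [h']; rfl⟩

theorem expandK_spec {α : Type} (V : ℕ → ℝ≥0∞) (j k w p : ℕ)
    (hV1 : ∀ t, t.testBit 30 = true → V t = 0)
    (hV2 : ∀ t, t.testBit 30 = false → V (t % p) = V t) (xs : List ℕ) :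
    ∀ (t : ℕ) (acc : Tr) (cont : Tr → α), ∃ t', expandK j k w p xs t acc cont = cont t' ∧
      tot V t' = tot V acc + (w : ℝ≥0∞) * esum V j k xs t := by
  induction xs with
  | nil => intro t acc cont; exact ⟨acc, rfl, by simp [esum]⟩
  | cons x xs ih =>
    intro t acc cont
    have hun : expandK j k w p (x :: xs) t acc cont =
      Bool.rec
        (forceNat (Nat.mod t p) fun q =>
          forceNat (hsh j q) fun h =>
          forceNat (Nat.mul w x) fun y =>
          insK h q y acc fun acc' =>
          forceNat (Nat.lor k (Nat.shiftLeft t j)) fun t' => expandK j k w p xs t' acc' cont)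
        (forceNat (Nat.lor k (Nat.shiftLeft t j)) fun t' => expandK j k w p xs t' acc cont)
        (Nat.beq (Nat.mod (Nat.div t 1073741824) 2) 1) := rfl
    rw [hun, bit30]
    simp only [forceNat_eq]
    cases hb : t.testBit 30 with
    | true =>
      obtain ⟨t', h1, h2⟩ := ih (Nat.lor k (Nat.shiftLeft t j)) acc cont
      refine ⟨t', h1, ?_⟩
      rw [h2, esum, hV1 t hb, mul_zero, zero_add]
      rfl
    | false =>
      obtain ⟨a', h3, h4⟩ := insK_spec V (hsh j (Nat.mod t p)) (Nat.mod t p) (Nat.mul w x) acc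
        (fun acc' => expandK j k w p xs (Nat.lor k (Nat.shiftLeft t j)) acc' cont)
      obtain ⟨t', h1, h2⟩ := ih (Nat.lor k (Nat.shiftLeft t j)) a' cont
      refine ⟨t', h3.trans h1, ?_⟩
      have e1 : V (Nat.mod t p) = V t := hV2 t hb
      have e2 : ((Nat.mul w x : ℕ) : ℝ≥0∞) = (w : ℝ≥0∞) * x := Nat.cast_mul w x
      rw [h2, h4, e1, e2, esum]
      have e3 : Nat.lor k (Nat.shiftLeft t j) = k ||| t <<< j := rfl
      rw [e3]
      ring

theorem stepK_spec {α : Type} (V : ℕ → ℝ≥0∞) (j p : ℕ)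
    (hV1 : ∀ t, t.testBit 30 = true → V t = 0)
    (hV2 : ∀ t, t.testBit 30 = false → V (t % p) = V t) (xs : List ℕ) (t : Tr) :
    ∀ (acc : Tr) (cont : Tr → α), ∃ t', stepK j p xs t acc cont = cont t' ∧
      tot V t' = tot V acc + tot (fun k => esum V j k xs k) t := by
  induction t with
  | nil => intro acc cont; exact ⟨acc, rfl, by simp [tot]⟩
  | node l h k w r ihl ihr =>
    intro acc cont
    have hun : stepK j p xs (.node l h k w r) acc cont =
      expandK j k w p xs k acc fun acc1 =>
      stepK j p xs l acc1 fun acc2 => stepK j p xs r acc2 cont := rfl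
    rw [hun]
    obtain ⟨a1, h1, h2⟩ := expandK_spec V j k w p hV1 hV2 xs k acc
      (fun acc1 => stepK j p xs l acc1 fun acc2 => stepK j p xs r acc2 cont)
    obtain ⟨a2, h3, h4⟩ := ihl a1 (fun acc2 => stepK j p xs r acc2 cont)
    obtain ⟨a3, h5, h6⟩ := ihr a2 cont
    refine ⟨a3, (h1.trans h3).trans h5, ?_⟩
    rw [h6, h4, h2]
    simp only [tot]
    ring

/-! ### weights -/

noncomputable def om (j a : ℕ) : ℝ≥0∞ := ((j ^ a * a.factorial : ℕ) : ℝ≥0∞)⁻¹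

theorem cpos {j : ℕ} (hj : 1 ≤ j) (a : ℕ) : 0 < j ^ a * a.factorial :=
  Nat.mul_pos (Nat.pow_pos hj) (Nat.factorial_pos a)

theorem wgt_lo {j : ℕ} (hj : 1 ≤ j) (a : ℕ) : (wgt 0 j a : ℝ≥0∞) ≤ dsc * om j a := by
  have hc := cpos hj a
  rw [om, ← div_eq_mul_inv, ENNReal.le_div_iff_mul_le (Or.inl (by exact_mod_cast hc.ne'))
    (Or.inl (ENNReal.natCast_ne_top _))]
  have : wgt 0 j a * (j ^ a * a.factorial) ≤ dsc := Nat.div_mul_le_self dsc _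
  exact_mod_cast this

theorem wgt_hi {j : ℕ} (hj : 1 ≤ j) (a : ℕ) : dsc * om j a ≤ (wgt 1 j a : ℝ≥0∞) := by
  have hc := cpos hj a
  rw [om, ← div_eq_mul_inv, ENNReal.div_le_iff_le_mul (Or.inl (by exact_mod_cast hc.ne'))
    (Or.inl (ENNReal.natCast_ne_top _))]
  have : dsc ≤ wgt 1 j a * (j ^ a * a.factorial) := by
    have h := Nat.lt_mul_div_succ dsc hc
    have e : wgt 1 j a = dsc / (j ^ a * a.factorial) + 1 := rfl
    rw [e, mul_comm]; exact h.le
  exact_mod_cast this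

theorem wsum_eq (e j n : ℕ) : ∀ i, wsum e j i n = ∑ a ∈ Finset.range n, wgt e j (a + i) := by
  induction n with
  | zero => intro i; rfl
  | succ n ih =>
    intro i
    have : wsum e j i (n + 1) = wgt e j i + wsum e j (i + 1) n := rfl
    rw [this, ih, Finset.sum_range_succ', add_comm]
    rw [Nat.zero_add]
    congr 1
    exact Finset.sum_congr rfl fun a _ => by rw [show a + (i + 1) = a + 1 + i by omega]

theorem om_tail {j : ℕ} (hj : 1 ≤ j) : (dsc : ℝ≥0∞) * ∑' a, om j (a + 31) ≤ 1 := by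
  have h1 : ∀ a, om j (a + 31) ≤ ((Nat.factorial 31 : ℕ) : ℝ≥0∞)⁻¹ * (2⁻¹ : ℝ≥0∞) ^ a := by
    intro a
    rw [← ENNReal.inv_pow, ← ENNReal.mul_inv (Or.inr (by simp)) (Or.inl (by simp)), om]
    apply ENNReal.inv_le_inv.2
    have : Nat.factorial 31 * 2 ^ a ≤ j ^ (a + 31) * (a + 31).factorial := by
      calc Nat.factorial 31 * 2 ^ a ≤ Nat.factorial 31 * (31 + 1) ^ a := by gcongr; norm_num
        _ ≤ (31 + a).factorial := Nat.factorial_mul_pow_le_factorial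
        _ = (a + 31).factorial := by rw [add_comm]
        _ ≤ _ := Nat.le_mul_of_pos_left _ (Nat.pow_pos hj)
    exact_mod_cast this
  calc (dsc : ℝ≥0∞) * ∑' a, om j (a + 31)
      ≤ dsc * ∑' a, ((Nat.factorial 31 : ℕ) : ℝ≥0∞)⁻¹ * (2⁻¹ : ℝ≥0∞) ^ a := by
        gcongr with a; exact h1 a
    _ = dsc * (((Nat.factorial 31 : ℕ) : ℝ≥0∞)⁻¹ * 2) := by
        rw [ENNReal.tsum_mul_left, ENNReal.tsum_geometric, ENNReal.one_sub_inv_two, inv_inv]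
    _ = (dsc * 2 : ℝ≥0∞) / ((Nat.factorial 31 : ℕ) : ℝ≥0∞) := by
        rw [div_eq_mul_inv]; ring
    _ ≤ 1 := by
        apply ENNReal.div_le_of_le_mul
        rw [one_mul]
        have : dsc * 2 ≤ Nat.factorial 31 := by unfold dsc; decide
        exact_mod_cast this

theorem tail_split (j m : ℕ) (hm : m ≤ 31) : ∑' a, om j (a + m) =
    ∑ a ∈ Finset.range (31 - m), om j (a + m) + ∑' a, om j (a + 31) := by
  have h := Summable.sum_add_tsum_nat_add' (f := fun a => om j (a + m)) (k := 31 - m)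
    ENNReal.summable
  have h2 : ∀ a, om j (a + (31 - m) + m) = om j (a + 31) := by
    intro a
    rw [show a + (31 - m) + m = a + 31 by omega]
  simp only [h2] at h
  exact h.symm

theorem wtail_lo {j : ℕ} (hj : 1 ≤ j) (m : ℕ) (hm : m ≤ 31) :
    (wtail 0 j m : ℝ≥0∞) ≤ dsc * ∑' a, om j (a + m) := by
  have e : wtail 0 j m = wsum 0 j m (31 - m) := rfl
  rw [e, wsum_eq, tail_split j m hm, mul_add, Finset.mul_sum]
  push_cast
  refine le_trans ?_ le_self_add
  exact Finset.sum_le_sum fun a _ => wgt_lo hj _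

theorem wtail_hi {j : ℕ} (hj : 1 ≤ j) (m : ℕ) (hm : m ≤ 31) :
    dsc * ∑' a, om j (a + m) ≤ (wtail 1 j m : ℝ≥0∞) := by
  have e : wtail 1 j m = wsum 1 j m (31 - m) + 1 := rfl
  rw [e, wsum_eq, tail_split j m hm, mul_add, Finset.mul_sum]
  push_cast
  exact add_le_add (Finset.sum_le_sum fun a _ => wgt_hi hj _) (om_tail hj)

/-! ### the value functions -/

def Rch (S j n : ℕ) (m : Fin n → ℕ) : Prop :=
  ∃ s, S.testBit s = true ∧ ∃ c : Fin n → ℕ, (∀ i, c i ≤ m i) ∧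
    s + ∑ i : Fin n, (j + i + 1) * c i = 30

open Classical in
noncomputable def VV (n j S : ℕ) : ℝ≥0∞ :=
  ∑' m : Fin n → ℕ, if Rch S j n m then 0 else ∏ i : Fin n, om (j + i + 1) (m i)

/-- states after adding up to `a` copies of the part `j`. -/
def Ts (S j : ℕ) : ℕ → ℕ
  | 0 => S
  | a + 1 => S ||| (Ts S j a) <<< j

theorem Ts_testBit (S j a : ℕ) : ∀ t, (Ts S j a).testBit t = true ↔
    ∃ b ≤ a, ∃ s, S.testBit s = true ∧ t = s + j * b := by
  induction a with
  | zero =>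
    intro t
    constructor
    · intro h; exact ⟨0, le_rfl, t, h, by simp⟩
    · rintro ⟨b, hb, s, hs, rfl⟩
      obtain rfl : b = 0 := by omega
      simpa [Ts] using hs
  | succ a ih =>
    intro t
    simp only [Ts, Nat.testBit_or, Nat.testBit_shiftLeft, Bool.or_eq_true, Bool.and_eq_true,
      decide_eq_true_eq, ih]
    constructor
    · rintro (h | ⟨h, b, hb, s, hs, e⟩)
      · exact ⟨0, by omega, t, h, by simp⟩
      · refine ⟨b + 1, by omega, s, hs, ?_⟩
        rw [Nat.mul_add]; omega
    · rintro ⟨b, hb, s, hs, rfl⟩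
      rcases b with _ | b
      · left; simpa using hs
      · right
        refine ⟨?_, b, by omega, s, hs, ?_⟩ <;> rw [Nat.mul_add] <;> omega

theorem Rch_cons (S j n a : ℕ) (m : Fin n → ℕ) :
    Rch S j (n + 1) (Fin.cons a m : Fin (n + 1) → ℕ) ↔ Rch (Ts S (j + 1) a) (j + 1) n m := by
  have key : ∀ c : Fin n → ℕ, ∑ i : Fin n, (j + (i.succ : Fin (n + 1)) + 1) * c i =
      ∑ i : Fin n, (j + 1 + i + 1) * c i := by
    intro c
    refine Finset.sum_congr rfl fun i _ => ?_
    rw [Fin.val_succ, show j + (i.val + 1) + 1 = j + 1 + i.val + 1 by omega]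
  constructor
  · rintro ⟨s, hs, c, hc, e⟩
    rw [Fin.sum_univ_succ, key (fun i => c i.succ)] at e
    refine ⟨s + (j + 1) * c 0, (Ts_testBit _ _ _ _).2 ⟨c 0, by simpa using hc 0, s, hs, rfl⟩,
      fun i => c i.succ, fun i => by simpa using hc i.succ, ?_⟩
    rw [← e]; simp [add_assoc]
  · rintro ⟨t, ht, c, hc, e⟩
    obtain ⟨b, hb, s, hs, rfl⟩ := (Ts_testBit _ _ _ _).1 ht
    refine ⟨s, hs, (Fin.cons b c : Fin (n + 1) → ℕ), ?_, ?_⟩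
    · intro i
      refine Fin.cases ?_ (fun i => ?_) i
      · simpa using hb
      · simpa using hc i
    · rw [Fin.sum_univ_succ]
      simp only [Fin.cons_succ, Fin.cons_zero, key]
      rw [← e]; simp [add_assoc]

theorem VV_succ (n j S : ℕ) :
    VV (n + 1) j S = ∑' a, om (j + 1) a * VV n (j + 1) (Ts S (j + 1) a) := by
  classical
  unfold VV
  rw [← (Fin.consEquiv (fun _ : Fin (n + 1) => ℕ)).tsum_eq,
    ENNReal.summable.tsum_prod' (fun _ => ENNReal.summable)]
  refine tsum_congr fun a => ?_
  rw [← ENNReal.tsum_mul_left]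
  refine tsum_congr fun m => ?_
  have hc : (Fin.consEquiv (fun _ : Fin (n + 1) => ℕ)) (a, m) =
    (Fin.cons a m : Fin (n + 1) → ℕ) := rfl
  rw [hc]
  have hR := Rch_cons S j n a m
  by_cases h : Rch (Ts S (j + 1) a) (j + 1) n m
  · rw [if_pos h, if_pos (hR.2 h), mul_zero]
  · rw [if_neg h, if_neg (fun h' => h (hR.1 h')), Fin.prod_univ_succ]
    simp only [Fin.cons_zero, Fin.cons_succ, Fin.val_succ, Fin.val_zero, add_zero]
    congr 1
    refine Finset.prod_congr rfl fun i _ => ?_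
    rw [show j + (i.val + 1) + 1 = j + 1 + i.val + 1 by omega]

theorem VV_congr {n j S S' : ℕ} (h : ∀ m, Rch S j n m ↔ Rch S' j n m) :
    VV n j S = VV n j S' := by
  classical
  unfold VV
  refine tsum_congr fun m => ?_
  simp only [h m]

theorem VV_dead (n j S : ℕ) (h : S.testBit 30 = true) : VV n j S = 0 := by
  classical
  unfold VV
  rw [ENNReal.tsum_eq_zero]
  intro m
  rw [if_pos]
  exact ⟨30, h, fun _ => 0, fun _ => Nat.zero_le _, by simp⟩

theorem VV_mask (n j S : ℕ) (h : S.testBit 30 = false) :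
    VV n j (S % 2 ^ (30 - j)) = VV n j S := by
  apply VV_congr
  intro m
  constructor
  · rintro ⟨s, hs, c, hc, e⟩
    rw [Nat.testBit_mod_two_pow, Bool.and_eq_true] at hs
    exact ⟨s, hs.2, c, hc, e⟩
  · rintro ⟨s, hs, c, hc, e⟩
    refine ⟨s, ?_, c, hc, e⟩
    rw [Nat.testBit_mod_two_pow, Bool.and_eq_true, decide_eq_true_eq]
    refine ⟨?_, hs⟩
    by_cases hz : ∀ i, c i = 0
    · simp [hz] at e
      subst e
      rw [h] at hs
      exact absurd hs (by simp)
    · push Not at hz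
      obtain ⟨i, hi⟩ := hz
      have h1 : (j + i + 1) * c i ≤ ∑ i : Fin n, (j + i + 1) * c i :=
        Finset.single_le_sum (f := fun i : Fin n => (j + i + 1) * c i)
          (fun _ _ => Nat.zero_le _) (Finset.mem_univ i)
      have h2 : j + 1 ≤ (j + i + 1) * c i :=
        le_trans (by omega) (Nat.le_mul_of_pos_right _ (Nat.pos_of_ne_zero hi))
      omega

theorem VV_sat (n j' S j a : ℕ) (hj : 1 ≤ j) (ha : 30 / j ≤ a) :
    VV n j' (Ts S j a) = VV n j' (Ts S j (30 / j)) := by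
  apply VV_congr
  intro m
  constructor
  · rintro ⟨t, ht, c, hc, e⟩
    obtain ⟨b, hb, s, hs, rfl⟩ := (Ts_testBit _ _ _ _).1 ht
    refine ⟨_, (Ts_testBit _ _ _ _).2 ⟨b, ?_, s, hs, rfl⟩, c, hc, e⟩
    rw [Nat.le_div_iff_mul_le hj, mul_comm]
    omega
  · rintro ⟨t, ht, c, hc, e⟩
    obtain ⟨b, hb, s, hs, rfl⟩ := (Ts_testBit _ _ _ _).1 ht
    exact ⟨_, (Ts_testBit _ _ _ _).2 ⟨b, hb.trans ha, s, hs, rfl⟩, c, hc, e⟩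

theorem VV_succ' (n j S : ℕ) :
    VV (n + 1) j S = ∑ a ∈ Finset.range (30 / (j + 1)),
        om (j + 1) a * VV n (j + 1) (Ts S (j + 1) a) +
      (∑' a, om (j + 1) (a + 30 / (j + 1))) * VV n (j + 1) (Ts S (j + 1) (30 / (j + 1))) := by
  rw [VV_succ, ← ENNReal.tsum_mul_right]
  have h := Summable.sum_add_tsum_nat_add'
    (f := fun a => om (j + 1) a * VV n (j + 1) (Ts S (j + 1) a)) (k := 30 / (j + 1))
    ENNReal.summable
  rw [← h]
  congr 1
  refine tsum_congr fun a => ?_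
  rw [VV_sat n (j + 1) S (j + 1) (a + 30 / (j + 1)) (by omega) (by omega)]

theorem esum_wlist (V : ℕ → ℝ≥0∞) (e j k n : ℕ) : ∀ i,
    esum V j k (wlist e j i n) (Ts k j i) =
      ∑ a ∈ Finset.range n, (wgt e j (a + i) : ℝ≥0∞) * V (Ts k j (a + i)) +
        (wtail e j (n + i) : ℝ≥0∞) * V (Ts k j (n + i)) := by
  induction n with
  | zero => intro i; simp [wlist, esum]
  | succ n ih =>
    intro i
    have h := ih (i + 1)
    have e1 : Ts k j (i + 1) = k ||| (Ts k j i) <<< j := rfl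
    rw [wlist, esum, ← e1, h, Finset.sum_range_succ', Nat.zero_add,
      show n + 1 + i = n + (i + 1) by omega]
    have e2 : ∀ a, a + 1 + i = a + (i + 1) := fun a => by omega
    simp only [e2]
    ring

theorem stage_lo (n j k : ℕ) :
    esum (VV n (j + 1)) (j + 1) k (wlist 0 (j + 1) 0 (30 / (j + 1))) k ≤
      dsc * VV (n + 1) j k := by
  have h := esum_wlist (VV n (j + 1)) 0 (j + 1) k (30 / (j + 1)) 0
  rw [show Ts k (j + 1) 0 = k from rfl] at h
  rw [h, VV_succ', mul_add, Finset.mul_sum, ← mul_assoc]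
  simp only [add_zero]
  have hM : 30 / (j + 1) ≤ 31 := (Nat.div_le_self _ _).trans (by norm_num)
  refine add_le_add (Finset.sum_le_sum fun a _ => ?_) ?_
  · rw [← mul_assoc]; gcongr; exact wgt_lo (by omega) _
  · gcongr; exact wtail_lo (by omega) _ hM

theorem stage_hi (n j k : ℕ) : dsc * VV (n + 1) j k ≤
    esum (VV n (j + 1)) (j + 1) k (wlist 1 (j + 1) 0 (30 / (j + 1))) k := by
  have h := esum_wlist (VV n (j + 1)) 1 (j + 1) k (30 / (j + 1)) 0
  rw [show Ts k (j + 1) 0 = k from rfl] at h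
  rw [h, VV_succ', mul_add, Finset.mul_sum, ← mul_assoc]
  simp only [add_zero]
  have hM : 30 / (j + 1) ≤ 31 := (Nat.div_le_self _ _).trans (by norm_num)
  refine add_le_add (Finset.sum_le_sum fun a _ => ?_) ?_
  · rw [← mul_assoc]; gcongr; exact wgt_hi (by omega) _
  · gcongr; exact wtail_hi (by omega) _ hM

theorem tot_mono {V W : ℕ → ℝ≥0∞} (h : ∀ k, V k ≤ W k) (t : Tr) : tot V t ≤ tot W t := by
  induction t with
  | nil => exact le_rfl
  | node l _ k w r ihl ihr => simp only [tot]; gcongr; exact h k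

theorem tot_smul (c : ℝ≥0∞) (V : ℕ → ℝ≥0∞) (t : Tr) :
    tot (fun k => c * V k) t = c * tot V t := by
  induction t with
  | nil => simp [tot]
  | node l _ k w r ihl ihr => simp only [tot, ihl, ihr]; ring

theorem run_step {α : Type} (e n j : ℕ) (t : Tr) (cont : Tr → α) :
    ∃ t', runK e (n + 1) j t cont = runK e n (j + 1) t' cont ∧
      tot (VV n (j + 1)) t' =
        tot (fun k => esum (VV n (j + 1)) (j + 1) k (wlist e (j + 1) 0 (30 / (j + 1))) k) t := by
  have hun : runK e (n + 1) j t cont =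
    listForce (wlist e (j + 1) 0 (30 / (j + 1))) fun xs =>
    stepK (j + 1) (Nat.pow 2 (Nat.sub 29 j)) xs t .nil fun t' =>
    runK e n (j + 1) t' cont := rfl
  rw [hun, listForce_eq]
  obtain ⟨t', h1, h2⟩ := stepK_spec (VV n (j + 1)) (j + 1) (Nat.pow 2 (Nat.sub 29 j))
    (fun t ht => VV_dead _ _ _ ht)
    (fun t ht => by
      have := VV_mask n (j + 1) t ht
      rwa [show 30 - (j + 1) = 29 - j by omega] at this)
    (wlist e (j + 1) 0 (30 / (j + 1))) t .nil (fun t' => runK e n (j + 1) t' cont)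
  exact ⟨t', h1, by rw [h2]; simp [tot]⟩

theorem run_lo {α : Type} (cont : Tr → α) (n : ℕ) : ∀ (j : ℕ) (t : Tr),
    ∃ t', runK 0 n j t cont = cont t' ∧
      tot (VV 0 (j + n)) t' ≤ (dsc : ℝ≥0∞) ^ n * tot (VV n j) t := by
  induction n with
  | zero => intro j t; exact ⟨t, rfl, by simp⟩
  | succ n ih =>
    intro j t
    obtain ⟨t1, h1, h2⟩ := run_step 0 n j t cont
    obtain ⟨t2, h3, h4⟩ := ih (j + 1) t1
    refine ⟨t2, h1.trans h3, ?_⟩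
    rw [show j + (n + 1) = j + 1 + n by omega]
    refine h4.trans ?_
    rw [pow_succ, mul_assoc]
    gcongr
    rw [h2, ← tot_smul]
    exact tot_mono (fun k => stage_lo n j k) t

theorem run_hi {α : Type} (cont : Tr → α) (n : ℕ) : ∀ (j : ℕ) (t : Tr),
    ∃ t', runK 1 n j t cont = cont t' ∧
      (dsc : ℝ≥0∞) ^ n * tot (VV n j) t ≤ tot (VV 0 (j + n)) t' := by
  induction n with
  | zero => intro j t; exact ⟨t, rfl, by simp⟩
  | succ n ih =>
    intro j t
    obtain ⟨t1, h1, h2⟩ := run_step 1 n j t cont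
    obtain ⟨t2, h3, h4⟩ := ih (j + 1) t1
    refine ⟨t2, h1.trans h3, ?_⟩
    rw [show j + (n + 1) = j + 1 + n by omega]
    refine le_trans ?_ h4
    rw [pow_succ, mul_assoc]
    gcongr
    rw [h2, ← tot_smul]
    exact tot_mono (fun k => stage_hi n j k) t

theorem VV_zero_le (j k : ℕ) : VV 0 j k ≤ 1 := by
  classical
  unfold VV
  rw [tsum_fintype]
  simp
  split_ifs <;> simp

theorem VV_zero_zero (j : ℕ) : VV 0 j 0 = 1 := by
  classical
  unfold VV
  rw [tsum_fintype]
  simp [Rch]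

theorem tot_le_wt (j : ℕ) (t : Tr) : tot (VV 0 j) t ≤ wt t := by
  induction t with
  | nil => simp [tot]
  | node l _ k w r ihl ihr =>
    simp only [tot, wt]; push_cast
    gcongr
    exact (mul_le_mul_right (VV_zero_le j k) _).trans (mul_one _).le

theorem wt0_le_tot (j : ℕ) (t : Tr) : (wt0 t : ℝ≥0∞) ≤ tot (VV 0 j) t := by
  induction t with
  | nil => simp [wt0]
  | node l _ k w r ihl ihr =>
    simp only [tot, wt0]; push_cast
    gcongr
    cases hb : Nat.beq k 0 with
    | true =>
      have : k = 0 := Nat.eq_of_beq_eq_true hb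
      subst this
      rw [VV_zero_zero]; simp
    | false => simp

/-! ### the computation -/

theorem chk_lo : runK 0 30 0 (.node .nil 0 1 1 .nil)
    (fun t => Nat.ble (706513885 * prodA 1 30 + 1) (wt0 t * 10 ^ 9)) = true := by decide +kernel

theorem chk_hi : runK 1 30 0 (.node .nil 0 1 1 .nil)
    (fun t => Nat.ble (wt t * 10 ^ 9 + 1) (706513895 * prodA 0 30)) = true := by decide +kernel

theorem lo_bound : ∃ N : ℕ, 706513885 * prodA 1 30 < N * 10 ^ 9 ∧
    (N : ℝ≥0∞) ≤ (dsc : ℝ≥0∞) ^ 30 * VV 30 0 1 := by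
  obtain ⟨t', h1, h2⟩ := run_lo
    (fun t => Nat.ble (706513885 * prodA 1 30 + 1) (wt0 t * 10 ^ 9)) 30 0 (.node .nil 0 1 1 .nil)
  rw [chk_lo] at h1
  refine ⟨wt0 t', Nat.le_of_ble_eq_true h1.symm, (wt0_le_tot _ _).trans (h2.trans ?_)⟩
  simp [tot]

theorem hi_bound : ∃ N : ℕ, N * 10 ^ 9 < 706513895 * prodA 0 30 ∧
    (dsc : ℝ≥0∞) ^ 30 * VV 30 0 1 ≤ (N : ℝ≥0∞) := by
  obtain ⟨t', h1, h2⟩ := run_hi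
    (fun t => Nat.ble (wt t * 10 ^ 9 + 1) (706513895 * prodA 0 30)) 30 0 (.node .nil 0 1 1 .nil)
  rw [chk_hi] at h1
  refine ⟨wt t', Nat.le_of_ble_eq_true h1.symm, le_trans (le_trans ?_ h2) (tot_le_wt _ _)⟩
  simp [tot]

theorem om_toReal (j a : ℕ) : (om j a).toReal = (1 / (j : ℝ)) ^ a / (a.factorial : ℝ) := by
  rw [om, ENNReal.toReal_inv, ENNReal.toReal_natCast]
  push_cast
  rw [mul_inv, one_div, inv_pow, div_eq_mul_inv]

theorem om_ne_top {j : ℕ} (hj : 1 ≤ j) (a : ℕ) : om j a ≠ ∞ := by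
  rw [om, ENNReal.inv_ne_top]
  exact_mod_cast (cpos hj a).ne'

theorem exp_om {j : ℕ} (hj : 1 ≤ j) : (∑' a, om j a).toReal = Real.exp (1 / (j : ℝ)) := by
  rw [ENNReal.tsum_toReal_eq (fun a => om_ne_top hj a), Real.exp_eq_exp_ℝ,
    NormedSpace.exp_eq_tsum_div]
  exact tsum_congr fun a => om_toReal j a

theorem exp_lo {j : ℕ} (hj : 1 ≤ j) : (wtail 0 j 0 : ℝ) ≤ dsc * Real.exp (1 / (j : ℝ)) := by
  have h := wtail_lo hj 0 (by norm_num)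
  have h' := wtail_hi hj 0 (by norm_num)
  generalize wtail 0 j 0 = A at h ⊢
  generalize wtail 1 j 0 = B at h'
  have := ENNReal.toReal_mono (ne_top_of_le_ne_top (ENNReal.natCast_ne_top _) h') h
  simp only [add_zero] at this
  rwa [ENNReal.toReal_mul, ENNReal.toReal_natCast, ENNReal.toReal_natCast, exp_om hj] at this

theorem exp_hi {j : ℕ} (hj : 1 ≤ j) : dsc * Real.exp (1 / (j : ℝ)) ≤ (wtail 1 j 0 : ℝ) := by
  have h := wtail_hi hj 0 (by norm_num)
  generalize wtail 1 j 0 = B at h ⊢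
  have := ENNReal.toReal_mono (ENNReal.natCast_ne_top _) h
  simp only [add_zero] at this
  rwa [ENNReal.toReal_mul, ENNReal.toReal_natCast, ENNReal.toReal_natCast, exp_om hj] at this

noncomputable def expProd (n : ℕ) : ℝ := ∏ j : Fin n, Real.exp (1 / ((j : ℕ) + 1 : ℝ))

theorem expProd_succ (n : ℕ) : expProd (n + 1) = expProd n * Real.exp (1 / ((n : ℕ) + 1 : ℝ)) := by
  simp [expProd, Fin.prod_univ_castSucc]

theorem expProd_pos (n : ℕ) : 0 < expProd n := Finset.prod_pos fun _ _ => Real.exp_pos _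

theorem prodA_lo (n : ℕ) : (prodA 0 n : ℝ) ≤ (dsc : ℝ) ^ n * expProd n := by
  induction n with
  | zero => simp [prodA, expProd]
  | succ n ih =>
    have h := exp_lo (j := n + 1) (by omega)
    rw [expProd_succ, pow_succ, prodA]
    push_cast at h ⊢
    calc (prodA 0 n : ℝ) * wtail 0 (n + 1) 0
        ≤ ((dsc : ℝ) ^ n * expProd n) * (dsc * Real.exp (1 / ((n : ℝ) + 1))) := by
          exact mul_le_mul ih h (Nat.cast_nonneg _)
            (mul_nonneg (pow_nonneg (Nat.cast_nonneg _) _) (expProd_pos n).le)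
      _ = _ := by ring

theorem prodA_hi (n : ℕ) : (dsc : ℝ) ^ n * expProd n ≤ (prodA 1 n : ℝ) := by
  induction n with
  | zero => simp [prodA, expProd]
  | succ n ih =>
    have h := exp_hi (j := n + 1) (by omega)
    rw [expProd_succ, pow_succ, prodA]
    push_cast at h ⊢
    calc _ = ((dsc : ℝ) ^ n * expProd n) * (dsc * Real.exp (1 / ((n : ℝ) + 1))) := by ring
      _ ≤ (prodA 1 n : ℝ) * wtail 1 (n + 1) 0 :=
          mul_le_mul ih h (mul_nonneg (Nat.cast_nonneg _) (Real.exp_pos _).le)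
            (Nat.cast_nonneg _)

theorem Rch_one (k : Fin 30 → ℕ) : Rch 1 0 30 k ↔ HasSubpartitionFin 30 k 30 := by
  have key : ∀ c : Fin 30 → ℕ, 0 + ∑ i : Fin 30, (0 + (i : ℕ) + 1) * c i =
      ∑ i : Fin 30, ((i : ℕ) + 1) * c i := by
    intro c
    rw [Nat.zero_add]
    exact Finset.sum_congr rfl fun i _ => by rw [Nat.zero_add]
  constructor
  · rintro ⟨s, hs, c, hc, e⟩
    have h0 : s = 0 := by
      by_contra h
      obtain ⟨s, rfl⟩ := Nat.exists_eq_succ_of_ne_zero h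
      simp [Nat.testBit_succ] at hs
    subst h0
    exact ⟨c, hc, (key c).symm.trans e⟩
  · rintro ⟨c, hc, e⟩
    exact ⟨0, rfl, c, hc, (key c).trans e⟩

theorem pInf_eq : pInf 30 = (VV 30 0 1).toReal / expProd 30 := by
  classical
  have hV : VV 30 0 1 = ∑' m : {m : Fin 30 → ℕ // ¬ HasSubpartitionFin 30 m 30},
      ∏ i : Fin 30, om ((i : ℕ) + 1) (m.1 i) := by
    unfold VV
    have e := tsum_subtype {m : Fin 30 → ℕ | ¬ HasSubpartitionFin 30 m 30}
      (fun m => ∏ i : Fin 30, om ((i : ℕ) + 1) (m i))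
    refine Eq.trans ?_ e.symm
    refine tsum_congr fun m => ?_
    by_cases h : HasSubpartitionFin 30 m 30
    · rw [if_pos ((Rch_one m).2 h), Set.indicator_of_notMem (by simpa using h)]
    · rw [if_neg (fun h' => h ((Rch_one m).1 h')), Set.indicator_of_mem (by simpa using h)]
      simp only [Nat.zero_add]
  rw [hV, ENNReal.tsum_toReal_eq, div_eq_mul_inv, mul_comm, ← tsum_mul_left]
  · unfold pInf
    refine tsum_congr fun m => ?_
    rw [ENNReal.toReal_prod, expProd, ← Finset.prod_inv_distrib, ← Finset.prod_mul_distrib]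
    refine Finset.prod_congr rfl fun i _ => ?_
    rw [om_toReal, ← Real.exp_neg]
    push_cast
    ring
  · intro m
    exact ENNReal.prod_ne_top fun i _ => om_ne_top (by omega) _

/-- `i(∞,30) = 1 - p(∞,30)` equals `0.29348611` to eight decimal places. -/
theorem iInf_thirty : |(1 - pInf 30) - 0.29348611| < 5 / 10 ^ 9 := by
  obtain ⟨N₁, a1, b1⟩ := lo_bound
  obtain ⟨N₂, a2, b2⟩ := hi_bound
  have c1 := ENNReal.toReal_mono (ne_top_of_le_ne_top (ENNReal.natCast_ne_top _) b2) b1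
  have c2 := ENNReal.toReal_mono (ENNReal.natCast_ne_top _) b2
  rw [ENNReal.toReal_mul, ENNReal.toReal_pow, ENNReal.toReal_natCast, ENNReal.toReal_natCast]
    at c1 c2
  have d1 := prodA_lo 30
  have d2 := prodA_hi 30
  have a1' : (706513885 : ℝ) * (prodA 1 30 : ℝ) < N₁ * 10 ^ 9 := by exact_mod_cast a1
  have a2' : (N₂ : ℝ) * 10 ^ 9 < 706513895 * (prodA 0 30 : ℝ) := by exact_mod_cast a2
  have hP := expProd_pos 30
  rw [pInf_eq]
  generalize expProd 30 = P at *
  generalize (VV 30 0 1).toReal = X at *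
  generalize (prodA 0 30 : ℝ) = A₀ at *
  generalize (prodA 1 30 : ℝ) = A₁ at *
  have hD : (0 : ℝ) < (dsc : ℝ) ^ 30 := by
    have : 0 < dsc := by unfold dsc; norm_num
    positivity
  generalize (dsc : ℝ) ^ 30 = D at *
  have e1 : 706513885 * P < X * 10 ^ 9 := by
    refine lt_of_mul_lt_mul_left (a := D) ?_ hD.le
    nlinarith
  have e2 : X * 10 ^ 9 < 706513895 * P := by
    refine lt_of_mul_lt_mul_left (a := D) ?_ hD.le
    nlinarith
  have f1 : 0.706513885 < X / P := by rw [lt_div_iff₀ hP]; linarith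
  have f2 : X / P < 0.706513895 := by rw [div_lt_iff₀ hP]; linarith
  rw [abs_lt]
  constructor <;> norm_num at f1 f2 ⊢ <;> linarith
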